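/- Let 0<Δ<1 and let C₂ be the constant from the upper-bound estimate. There exist constants C₃>0 and h₀∈(0,1), depending only on Δ, such that for every h∈(0,h₀): if y ∈ C²(cl(B₁); ℝ³) satisfies I_{h,Δ}(y) ≤ 2πΔ²h²(log(1/h) + C₂), then for every R ∈ (2h,1) one has ∫_{B₁∖B_R} |D²y|² dL² ≤ 2πΔ² log(1/R) + C₃. -/

import Mathlib

open MeasureTheory Metric Real Filter Matrix
open scoped ENNReal Topology

noncomputable section

/-- The plane `ℝ²` with the Euclidean norm. -/
abbrev E2 : Type := EuclideanSpace ℝ (Fin 2)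
/-- The space `ℝ³` with the Euclidean norm. -/
abbrev E3 : Type := EuclideanSpace ℝ (Fin 3)

/-- The `i`-th standard basis vector of `ℝ²`. -/
def e2 (i : Fin 2) : E2 := EuclideanSpace.single i 1

/-- Partial derivative in the direction of the `i`-th coordinate. -/
def pd (i : Fin 2) (f : E2 → ℝ) (x : E2) : ℝ := fderiv ℝ f x (e2 i)

/-- Hessian matrix of a scalar function on `ℝ²`. -/
def hess (f : E2 → ℝ) (x : E2) : Matrix (Fin 2) (Fin 2) ℝ :=
  Matrix.of fun i j => pd i (pd j f) x

/-- Derivative matrix `Dy ∈ ℝ^{3×2}` of a map `y : ℝ² → ℝ³`. -/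
def Dmat (y : E2 → E3) (x : E2) : Matrix (Fin 3) (Fin 2) ℝ :=
  Matrix.of fun i j => pd j (fun z => y z i) x

/-- Induced metric `g_y = (Dy)ᵀ Dy`. -/
def gmet (y : E2 → E3) (x : E2) : Matrix (Fin 2) (Fin 2) ℝ :=
  (Dmat y x)ᵀ * Dmat y x

/-- The rotated vector `x⊥ = (-x₂, x₁)`. -/
def perpVec (x : E2) : Fin 2 → ℝ := ![-(x 1), x 0]

/-- The unit tangent `x̂⊥ = (-x₂, x₁)/|x|`. -/
def xperpUnit (x : E2) : Fin 2 → ℝ := fun i => perpVec x i / ‖x‖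

/-- The reference (cone) metric `g_Δ = Id - Δ² x̂⊥ ⊗ x̂⊥`. -/
def gDelta (Δ : ℝ) (x : E2) : Matrix (Fin 2) (Fin 2) ℝ :=
  1 - Matrix.of fun i j => (Δ ^ 2 / ‖x‖ ^ 2) * perpVec x i * perpVec x j

/-- Squared Frobenius norm of a matrix. -/
def frob2 {m n : Type*} [Fintype m] [Fintype n] (A : Matrix m n ℝ) : ℝ :=
  ∑ i, ∑ j, (A i j) ^ 2

/-- `|D²y|²`: the sum of the squared Frobenius norms of the Hessians of the components. -/
def hessNormSq (y : E2 → E3) (x : E2) : ℝ :=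
  ∑ i : Fin 3, frob2 (hess (fun z => y z i) x)

/-- The free elastic energy `I_{h,Δ}(y)`. -/
def energy (h Δ : ℝ) (y : E2 → E3) : ℝ :=
  ∫ x in ball (0 : E2) 1, (frob2 (gmet y x - gDelta Δ x) + h ^ 2 * hessNormSq y x)

/-- The singular cone `y^Δ(x) = √(1-Δ²)·(x,0) + Δ|x| e₃`. -/
def coneMap (Δ : ℝ) (x : E2) : E3 :=
  (WithLp.equiv 2 (Fin 3 → ℝ)).symm
    ![Real.sqrt (1 - Δ ^ 2) * x 0, Real.sqrt (1 - Δ ^ 2) * x 1, Δ * ‖x‖]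


theorem circ_ineq (u v u' v' : ℝ → ℝ) (hu : ∀ x, HasDerivAt u (u' x) x)
    (hv : ∀ x, HasDerivAt v (v' x) x) (hu' : Continuous u') (hv' : Continuous v')
    (pu : u (-π) = u π) (pv : v (-π) = v π) :
    ∫ t in (-π)..π, (u t * v' t - v t * u' t) ≤ ∫ t in (-π)..π, (u' t ^ 2 + v' t ^ 2) := by
  have hab : (-π) < π := by linarith [Real.pi_pos]
  have cu : Continuous u := continuous_iff_continuousAt.2 fun x => (hu x).continuousAt
  have cv : Continuous v := continuous_iff_continuousAt.2 fun x => (hv x).continuousAt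
  set f : ℝ → ℂ := fun t => (u t : ℂ) + (v t : ℂ) * Complex.I with hf
  set f' : ℝ → ℂ := fun t => (u' t : ℂ) + (v' t : ℂ) * Complex.I with hf'
  set F : ℝ → ℂ := fun t => f' t - (Complex.I / 2) * f t with hF
  have cf : Continuous f := by fun_prop
  have cf' : Continuous f' := by fun_prop
  have cF : Continuous F := by fun_prop
  have hd : ∀ x, HasDerivAt f (f' x) x := fun x =>
    ((hu x).ofReal_comp).add (((hv x).ofReal_comp).mul_const _)
  have pf : f π - f (-π) = 0 := by simp [hf, pu, pv]
  have hmem : ∀ g : ℝ → ℂ, Continuous g → MemLp g 2 (volume.restrict (Set.Ioc (-π) π)) := by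
    intro g hg
    rw [memLp_two_iff_integrable_sq_norm hg.aestronglyMeasurable]
    have h2 : Continuous fun x => ‖g x‖ ^ 2 := by fun_prop
    exact h2.integrableOn_Ioc
  have hd_n : ∀ n : ℤ, fourierCoeffOn hab f' n = Complex.I * n * fourierCoeffOn hab f n := by
    intro n
    by_cases hn : n = 0
    · subst hn
      rw [fourierCoeffOn_eq_integral]
      have : ∫ x in (-π)..π, f' x = 0 := by
        rw [intervalIntegral.integral_eq_sub_of_hasDerivAt (fun x _ => hd x)
          (cf'.intervalIntegrable _ _), pf]
      simp [this]
    · have h1 := fourierCoeffOn_of_hasDerivAt hab hn (fun x _ => hd x)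
        (cf'.intervalIntegrable (-π) π)
      rw [pf] at h1
      rw [h1]
      have hnC : (n : ℂ) ≠ 0 := by exact_mod_cast hn
      have hpi : (π : ℂ) ≠ 0 := by exact_mod_cast Real.pi_ne_zero
      push_cast
      field_simp
      ring
  have hFn : ∀ n : ℤ, fourierCoeffOn hab F n =
      Complex.I * (n - 1/2) * fourierCoeffOn hab f n := by
    intro n
    have : fourierCoeffOn hab F n = fourierCoeffOn hab f' n - Complex.I / 2 * fourierCoeffOn hab f n := by
      simp only [fourierCoeffOn_eq_integral, hF, smul_eq_mul, mul_sub]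
      rw [intervalIntegral.integral_sub]
      · have : ∀ x : ℝ, (fourier (-n) (x : AddCircle (π - -π))) * (Complex.I / 2 * f x) =
          (Complex.I / 2) * ((fourier (-n) (x : AddCircle (π - -π))) * f x) := by intro x; ring
        simp only [this, intervalIntegral.integral_const_mul]
        simp only [Complex.real_smul]
        ring
      all_goals
        apply Continuous.intervalIntegrable
        have := (fourier (T := π - -π) (-n)).continuous.comp (AddCircle.continuous_mk' (π - -π))
        first | exact this.mul cf' | exact this.mul (continuous_const.mul cf)
    rw [this, hd_n]; ring
  have s1 := hasSum_sq_fourierCoeffOn hab (hmem F cF)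
  have s2 := hasSum_sq_fourierCoeffOn hab (hmem f cf)
  have key := hasSum_le (f := fun i => (1/4) * ‖fourierCoeffOn hab f i‖ ^ 2)
    (fun n => by
      rw [hFn]
      simp only [norm_mul, Complex.norm_I, one_mul, mul_pow]
      gcongr
      have : ((n : ℂ) - 1/2) = (((n : ℝ) - 1/2 : ℝ) : ℂ) := by push_cast; ring
      rw [this, Complex.norm_real, Real.norm_eq_abs, sq_abs]
      have : (0:ℝ) ≤ n * (n - 1) := by
        have : (0:ℤ) ≤ n * (n-1) := by
          rcases le_or_gt n 0 with h | h <;> nlinarith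
        exact_mod_cast this
      nlinarith) (s2.mul_left (1/4)) s1
  have e1 : ∀ x, ‖F x‖^2 = (u' x ^2 + v' x ^2) - (u x * v' x - v x * u' x) + (1/4) * ‖f x‖^2 := by
    intro x
    rw [← Complex.normSq_eq_norm_sq, ← Complex.normSq_eq_norm_sq, Complex.normSq_apply, Complex.normSq_apply]
    simp [hF, hf, hf']
    ring
  simp only [e1, smul_eq_mul] at key
  rw [intervalIntegral.integral_add, intervalIntegral.integral_sub,
    intervalIntegral.integral_const_mul] at key
  · have hp : 0 < (π - -π)⁻¹ := by
      apply inv_pos.2; linarith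
    have : (1/4) * ((π - -π)⁻¹ * ∫ x in (-π)..π, ‖f x‖^2) = (π - -π)⁻¹ * ((1/4) * ∫ x in (-π)..π, ‖f x‖^2) := by ring
    rw [this] at key
    have := le_of_mul_le_mul_left key hp
    linarith
  all_goals
    apply Continuous.intervalIntegrable
    fun_prop

/-- Polar coordinates. -/
def PP (p : ℝ × ℝ) : E2 := !₂[p.1 * Real.cos p.2, p.1 * Real.sin p.2]

theorem PP_cont : Continuous PP := by
  unfold PP
  fun_prop

theorem PP_norm (p : ℝ × ℝ) (hp : 0 ≤ p.1) : ‖PP p‖ = p.1 := by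
  rw [EuclideanSpace.norm_eq]
  simp only [PP, Fin.sum_univ_two, Real.norm_eq_abs, sq_abs]
  simp only [Matrix.cons_val_zero, Matrix.cons_val_one]
  rw [show (p.1 * Real.cos p.2)^2 + (p.1 * Real.sin p.2)^2 = p.1^2 by
    nlinarith [Real.sin_sq_add_cos_sq p.2]]
  exact Real.sqrt_sq hp

theorem polar_int (G : E2 → ℝ) (a b : ℝ) (ha : 0 < a) :
    ∫ x in ball (0 : E2) b \ ball 0 a, G x =
      ∫ p in Set.Ico a b ×ˢ Set.Ioo (-π) π, p.1 * G (PP p) := by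
  have hm : MeasurableSet (ball (0 : E2) b \ ball 0 a) := measurableSet_ball.diff measurableSet_ball
  rw [← integral_indicator hm]
  have mp := (Complex.orthonormalBasisOneI.repr).measurePreserving
  rw [← mp.integral_comp' (f := Complex.orthonormalBasisOneI.repr.toMeasurableEquiv),
    ← Complex.integral_comp_polarCoord_symm]
  have hP : ∀ p : ℝ × ℝ, Complex.orthonormalBasisOneI.repr (Complex.polarCoord.symm p) = PP p := by
    intro p
    ext i
    have := congrFun (Complex.orthonormalBasisOneI_repr_apply (Complex.polarCoord.symm p)) i
    rw [this]
    fin_cases i <;> simp [PP, Complex.cos_ofReal_re, Complex.sin_ofReal_re]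
  have hsub : Set.Ico a b ×ˢ Set.Ioo (-π) π ⊆ polarCoord.target := by
    rw [polarCoord_target]
    exact Set.prod_mono (fun x hx => lt_of_lt_of_le ha hx.1) subset_rfl
  rw [← integral_indicator polarCoord.open_target.measurableSet,
    ← integral_indicator (measurableSet_Ico.prod measurableSet_Ioo)]
  congr 1
  funext p
  by_cases hp : p ∈ polarCoord.target
  · rw [Set.indicator_of_mem hp]
    have hp1 : 0 < p.1 := hp.1
    have hp2 : p.2 ∈ Set.Ioo (-π) π := hp.2
    change p.1 • (ball (0 : E2) b \ ball 0 a).indicator G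
      (Complex.orthonormalBasisOneI.repr (Complex.polarCoord.symm p)) = _
    rw [hP]
    have hiff : PP p ∈ ball (0 : E2) b \ ball 0 a ↔ p ∈ Set.Ico a b ×ˢ Set.Ioo (-π) π := by
      simp only [Set.mem_sdiff, mem_ball_zero_iff, PP_norm p hp1.le, Set.mem_prod, Set.mem_Ico, hp2,
        and_true, not_lt]
      tauto
    by_cases h : p ∈ Set.Ico a b ×ˢ Set.Ioo (-π) π
    · rw [Set.indicator_of_mem h, Set.indicator_of_mem (hiff.2 h), smul_eq_mul]
    · rw [Set.indicator_of_notMem h, Set.indicator_of_notMem (fun h' => h (hiff.1 h')), smul_zero]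
  · rw [Set.indicator_of_notMem hp, Set.indicator_of_notMem (fun h => hp (hsub h))]

theorem e2_comb (a b : ℝ) : (!₂[a, b] : E2) = a • e2 0 + b • e2 1 := by
  ext i; fin_cases i <;> simp [e2]

theorem PP_theta (g : E2 → ℝ) (hg : Differentiable ℝ g) (r t : ℝ) :
    HasDerivAt (fun t => g (PP (r, t)))
      (r * (-Real.sin t * pd 0 g (PP (r,t)) + Real.cos t * pd 1 g (PP (r,t)))) t := by
  have h1 : HasDerivAt (fun t => PP (r, t)) (-(r * Real.sin t) • e2 0 + (r * Real.cos t) • e2 1) t := by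
    simp only [PP, e2_comb]
    have := (((Real.hasDerivAt_cos t).const_mul r).smul_const (e2 0)).add
      (((Real.hasDerivAt_sin t).const_mul r).smul_const (e2 1))
    refine this.congr_deriv ?_
    simp
  have := (hg (PP (r,t))).hasFDerivAt.comp_hasDerivAt t h1
  refine this.congr_deriv ?_
  simp only [map_add, map_smul, smul_eq_mul, pd]
  ring

theorem PP_r (g : E2 → ℝ) (hg : Differentiable ℝ g) (r t : ℝ) :
    HasDerivAt (fun r => g (PP (r, t)))
      (Real.cos t * pd 0 g (PP (r,t)) + Real.sin t * pd 1 g (PP (r,t))) r := by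
  have h1 : HasDerivAt (fun r => PP (r, t)) ((Real.cos t) • e2 0 + (Real.sin t) • e2 1) r := by
    simp only [PP, e2_comb]
    have := (((hasDerivAt_id r).mul_const (Real.cos t)).smul_const (e2 0)).add
      (((hasDerivAt_id r).mul_const (Real.sin t)).smul_const (e2 1))
    refine this.congr_deriv ?_
    simp
  have := (hg (PP (r,t))).hasFDerivAt.comp_hasDerivAt r h1
  refine this.congr_deriv ?_
  simp only [map_add, map_smul, smul_eq_mul, pd]

theorem pd_contDiff (f : E2 → ℝ) (hf : ContDiff ℝ 2 f) (j : Fin 2) : ContDiff ℝ 1 (pd j f) := by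
  unfold pd
  exact (hf.fderiv_right (m := 1) (by norm_num)).clm_apply contDiff_const

theorem pd_cont (f : E2 → ℝ) (hf : ContDiff ℝ 1 f) (j : Fin 2) : Continuous (pd j f) := by
  unfold pd
  exact (hf.continuous_fderiv (by norm_num)).clm_apply continuous_const

theorem pd_symm (f : E2 → ℝ) (hf : ContDiff ℝ 2 f) (x : E2) :
    pd 1 (pd 0 f) x = pd 0 (pd 1 f) x := by
  have hd : DifferentiableAt ℝ (fderiv ℝ f) x :=
    ((hf.fderiv_right (m := 1) (by norm_num)).differentiable (by norm_num)) x
  have key : ∀ i j : Fin 2, pd i (pd j f) x = fderiv ℝ (fderiv ℝ f) x (e2 i) (e2 j) := by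
    intro i j
    unfold pd
    rw [fderiv_clm_apply hd (by fun_prop)]
    simp
  rw [key, key]
  exact (hf.contDiffAt.isSymmSndFDerivAt (by simp)) _ _

/-- The weight. -/
def ww (a b r : ℝ) : ℝ := 1 / r - a / r ^ 2 - 1 / b + a / (b * r)

/-- Its derivative. -/
def ww' (a b r : ℝ) : ℝ := -1 / r ^ 2 + 2 * a / r ^ 3 - a / (b * r ^ 2)

theorem ww_deriv (a b r : ℝ) (hr : 0 < r) (hb : 0 < b) : HasDerivAt (ww a b) (ww' a b r) r := by
  have h0 := hasDerivAt_id' r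
  have hfun : ww a b = fun x => x⁻¹ - a * (x ^ 2)⁻¹ - 1 / b + a / b * x⁻¹ := by
    funext x; unfold ww; rw [div_mul_eq_div_div]; simp only [div_eq_mul_inv]; ring
  rw [hfun]
  have := (((h0.fun_inv hr.ne').sub ((((h0.fun_pow 2).fun_inv (by simp [hr.ne']))).const_mul a)).sub
    (hasDerivAt_const r (1/b))).add ((h0.fun_inv hr.ne').const_mul (a / b))
  refine this.congr_deriv ?_
  unfold ww'
  simp; field_simp; ring

theorem ww_a (a b : ℝ) (ha : 0 < a) (hb : 0 < b) : ww a b a = 0 := by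
  unfold ww; field_simp; ring

theorem ww_b (a b : ℝ) (ha : 0 < a) (hb : 0 < b) : ww a b b = 0 := by
  unfold ww; field_simp; ring

theorem ww_eq (a b r : ℝ) (hb : 0 < b) (hr : 0 < r) : ww a b r = (r - a) * (b - r) / (r ^ 2 * b) := by
  unfold ww; field_simp; ring

theorem ww_nonneg (a b r : ℝ) (ha : 0 < a) (h1 : a ≤ r) (h2 : r ≤ b) : 0 ≤ ww a b r := by
  have hr : 0 < r := by linarith
  rw [ww_eq a b r (by linarith) hr]
  have : 0 ≤ r - a := by linarith
  have : 0 ≤ b - r := by linarith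
  have : 0 < b := by linarith
  positivity

theorem ww_le (a b r : ℝ) (ha : 0 < a) (h1 : a ≤ r) (h2 : r ≤ b) : ww a b r ≤ 1 / r := by
  have hr : 0 < r := by linarith
  have hb : 0 < b := by linarith
  rw [ww_eq a b r (by linarith) hr, div_le_div_iff₀ (by positivity) hr]
  have : (r - a) * (b - r) ≤ r * b := by nlinarith [mul_nonneg ha.le (sub_nonneg.2 h2), mul_pos hr hr]
  nlinarith

theorem ww'_abs (a b r : ℝ) (ha : 0 < a) (h1 : a ≤ r) (h2 : r ≤ b) : |ww' a b r| ≤ 4 / r ^ 2 := by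
  have hr : 0 < r := by linarith
  have hb : 0 < b := by linarith
  have : ww' a b r = (-1 + 2 * (a / r) - a / b) / r ^ 2 := by
    unfold ww'; field_simp
  rw [this, abs_div, abs_of_pos (show 0 < r ^ 2 by positivity)]
  gcongr
  have h3 : a / r ≤ 1 := (div_le_one hr).2 h1
  have h4 : a / b ≤ 1 := (div_le_one hb).2 (by linarith)
  have h5 : 0 < a / r := by positivity
  have h6 : 0 < a / b := by positivity
  rw [abs_le]; constructor <;> linarith

theorem ww_cont (a b : ℝ) (hb : 0 < b) : ContinuousOn (ww a b) (Set.Ioi 0) := by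
  unfold ww
  intro r hr
  have hr : r ≠ 0 := ne_of_gt hr
  apply ContinuousAt.continuousWithinAt
  fun_prop (disch := positivity)

theorem ww'_cont (a b : ℝ) (hb : 0 < b) : ContinuousOn (ww' a b) (Set.Ioi 0) := by
  unfold ww'
  intro r hr
  have hr : r ≠ 0 := ne_of_gt hr
  apply ContinuousAt.continuousWithinAt
  fun_prop (disch := positivity)

/-- The polar rectangle. -/
def SS (a b : ℝ) : Set (ℝ × ℝ) := Set.Ico a b ×ˢ Set.Ioo (-π) π

/-- Right half plane. -/
def HP : Set (ℝ × ℝ) := Set.Ioi 0 ×ˢ Set.univ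

theorem SS_meas (a b : ℝ) : MeasurableSet (SS a b) := measurableSet_Ico.prod measurableSet_Ioo

theorem int_SS (a b : ℝ) (ha : 0 < a) (F : ℝ × ℝ → ℝ) (hF : ContinuousOn F HP) :
    IntegrableOn F (SS a b) := by
  have h : IntegrableOn F (Set.Icc a b ×ˢ Set.Icc (-π) π) :=
    (hF.mono (Set.prod_mono (fun x hx => lt_of_lt_of_le ha hx.1) (Set.subset_univ _))).integrableOn_compact
      (isCompact_Icc.prod isCompact_Icc)
  exact h.mono_set (Set.prod_mono Set.Ico_subset_Icc_self Set.Ioo_subset_Icc_self)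

theorem SS_nonneg (a b : ℝ) (ha : 0 < a) (F : ℝ × ℝ → ℝ) (hF : ContinuousOn F HP)
    (h : ∀ r ∈ Set.Ico a b, 0 ≤ ∫ t in (-π)..π, F (r, t)) : 0 ≤ ∫ p in SS a b, F p := by
  have hi := int_SS a b ha F hF
  unfold SS at hi ⊢
  rw [Measure.volume_eq_prod] at hi ⊢
  rw [setIntegral_prod _ hi]
  apply setIntegral_nonneg measurableSet_Ico
  intro r hr
  have := h r hr
  rwa [intervalIntegral.integral_of_le (by linarith [Real.pi_pos]), integral_Ioc_eq_integral_Ioo] at this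

theorem SS_zero (a b : ℝ) (ha : 0 < a) (hab : a ≤ b) (F : ℝ × ℝ → ℝ) (hF : ContinuousOn F HP)
    (h : ∀ t, ∫ r in a..b, F (r, t) = 0) : ∫ p in SS a b, F p = 0 := by
  have hi := int_SS a b ha F hF
  unfold SS at hi ⊢
  rw [Measure.volume_eq_prod] at hi ⊢
  rw [setIntegral_prod _ hi]
  rw [integral_integral_swap]
  · apply integral_eq_zero_of_ae
    refine Eventually.of_forall fun t => ?_
    have := h t
    rw [intervalIntegral.integral_of_le hab, ← integral_Ico_eq_integral_Ioc] at this
    exact this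
  · rw [Measure.prod_restrict]
    exact hi

theorem claimA (f : E2 → ℝ) (hf : ContDiff ℝ 2 f) (a b : ℝ) (ha : 0 < a) (hab : a ≤ b) :
    0 ≤ ∫ p in SS a b,
      (ww a b p.1 * ((p.1 * (-sin p.2 * pd 0 (pd 0 f) (PP p) + cos p.2 * pd 1 (pd 0 f) (PP p))) ^ 2
        + (p.1 * (-sin p.2 * pd 0 (pd 1 f) (PP p) + cos p.2 * pd 1 (pd 1 f) (PP p))) ^ 2)
      - ww a b p.1 * (cos p.2 * pd 0 f (PP p) + sin p.2 * pd 1 f (PP p)) ^ 2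
      - ww' a b p.1 * p.1 * (-sin p.2 * pd 0 f (PP p) + cos p.2 * pd 1 f (PP p)) ^ 2) := by
  have hb : 0 < b := by linarith
  set u : ℝ × ℝ → ℝ := fun p => pd 0 f (PP p) with hu
  set v : ℝ × ℝ → ℝ := fun p => pd 1 f (PP p) with hv
  set U : ℝ × ℝ → ℝ := fun p => p.1 * (-sin p.2 * pd 0 (pd 0 f) (PP p) + cos p.2 * pd 1 (pd 0 f) (PP p)) with hU
  set V : ℝ × ℝ → ℝ := fun p => p.1 * (-sin p.2 * pd 0 (pd 1 f) (PP p) + cos p.2 * pd 1 (pd 1 f) (PP p)) with hV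
  have d0 := (pd_contDiff f hf 0)
  have d1 := (pd_contDiff f hf 1)
  have c0 := d0.continuous
  have c1 := d1.continuous
  have c00 := pd_cont _ d0 0
  have c10 := pd_cont _ d0 1
  have c01 := pd_cont _ d1 0
  have c11 := pd_cont _ d1 1
  have hP := PP_cont
  have cu : Continuous u := by fun_prop
  have cv : Continuous v := by fun_prop
  have cU : Continuous U := by fun_prop
  have cV : Continuous V := by fun_prop
  have cw : ContinuousOn (fun p : ℝ × ℝ => ww a b p.1) HP :=
    (ww_cont a b hb).comp continuous_fst.continuousOn (fun p hp => hp.1)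
  have cw' : ContinuousOn (fun p : ℝ × ℝ => ww' a b p.1) HP :=
    (ww'_cont a b hb).comp continuous_fst.continuousOn (fun p hp => hp.1)
  set F1 : ℝ × ℝ → ℝ := fun p => ww a b p.1 * ((U p ^ 2 + V p ^ 2) -
    ((cos p.2 * u p + sin p.2 * v p) ^ 2 - (-sin p.2 * u p + cos p.2 * v p) ^ 2
      - 2 * (-sin p.2 * u p + cos p.2 * v p) * (cos p.2 * U p + sin p.2 * V p))) with hF1
  set F2 : ℝ × ℝ → ℝ := fun p => ww a b p.1 * ((-sin p.2 * u p + cos p.2 * v p) ^ 2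
      + 2 * (-sin p.2 * u p + cos p.2 * v p) * (cos p.2 * U p + sin p.2 * V p))
      + ww' a b p.1 * (p.1 * (-sin p.2 * u p + cos p.2 * v p) ^ 2) with hF2
  have cF1 : ContinuousOn F1 HP := cw.mul (Continuous.continuousOn (by fun_prop))
  have cF2 : ContinuousOn F2 HP := (cw.mul (Continuous.continuousOn (by fun_prop))).add
    (cw'.mul (Continuous.continuousOn (by fun_prop)))
  have hut : ∀ r t, HasDerivAt (fun t => u (r, t)) (U (r, t)) t := fun r t =>
    PP_theta _ (d0.differentiable (by norm_num)) r t
  have hvt : ∀ r t, HasDerivAt (fun t => v (r, t)) (V (r, t)) t := fun r t =>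
    PP_theta _ (d1.differentiable (by norm_num)) r t
  have n1 : 0 ≤ ∫ p in SS a b, F1 p := by
    apply SS_nonneg a b ha F1 cF1
    intro r hr
    simp only [hF1]
    rw [intervalIntegral.integral_const_mul]
    refine mul_nonneg (ww_nonneg a b r ha hr.1 hr.2.le) ?_
    have hper : ∀ k : E2 → ℝ, k (PP (r, -π)) = k (PP (r, π)) := by
      intro k; simp [PP]
    have W := circ_ineq (fun t => u (r,t)) (fun t => v (r,t)) (fun t => U (r,t)) (fun t => V (r,t))
      (hut r) (hvt r) (by fun_prop) (by fun_prop) (hper (pd 0 f)) (hper (pd 1 f))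
    have hpq : ∀ t, HasDerivAt (fun t => (cos t * u (r,t) + sin t * v (r,t)) *
        (-sin t * u (r,t) + cos t * v (r,t)))
        ((u (r,t) * V (r,t) - v (r,t) * U (r,t)) - 
        ((cos t * u (r,t) + sin t * v (r,t)) ^ 2 - (-sin t * u (r,t) + cos t * v (r,t)) ^ 2
      - 2 * (-sin t * u (r,t) + cos t * v (r,t)) * (cos t * U (r,t) + sin t * V (r,t)))) t := by
      intro t
      have A := ((Real.hasDerivAt_cos t).mul (hut r t)).add ((Real.hasDerivAt_sin t).mul (hvt r t))
      have B := ((Real.hasDerivAt_sin t).neg.mul (hut r t)).add ((Real.hasDerivAt_cos t).mul (hvt r t))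
      refine (A.mul B).congr_deriv ?_
      simp only [Pi.add_apply, Pi.mul_apply, Pi.neg_apply]
      have h1 : cos t ^ 2 = 1 - sin t ^ 2 := by linarith [Real.sin_sq_add_cos_sq t]
      linear_combination (u (r,t) * V (r,t) - v (r,t) * U (r,t)) * h1
    have Z := intervalIntegral.integral_eq_sub_of_hasDerivAt (a := -π) (b := π) (fun t _ => hpq t)
      (Continuous.intervalIntegrable (by fun_prop) _ _)
    have hu0 : u (r, -π) = u (r, π) := hper (pd 0 f)
    have hv0 : v (r, -π) = v (r, π) := hper (pd 1 f)
    rw [intervalIntegral.integral_sub (Continuous.intervalIntegrable (by fun_prop) _ _)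
      (Continuous.intervalIntegrable (by fun_prop) _ _)] at Z
    rw [intervalIntegral.integral_sub (Continuous.intervalIntegrable (by fun_prop) _ _)
      (Continuous.intervalIntegrable (by fun_prop) _ _)]
    simp only [hu0, hv0, Real.cos_neg, Real.sin_neg, Real.sin_pi, neg_zero, sub_self] at Z
    linarith
  have n2 : ∫ p in SS a b, F2 p = 0 := by
    apply SS_zero a b ha hab F2 cF2
    intro t
    have hq : ∀ r ∈ Set.uIcc a b, HasDerivAt (fun r => ww a b r * (r * (-sin t * u (r,t) + cos t * v (r,t))^2))
        (F2 (r, t)) r := by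
      intro r hr
      rw [Set.uIcc_of_le hab] at hr
      have A := PP_r _ (d0.differentiable (by norm_num)) r t
      have B := PP_r _ (d1.differentiable (by norm_num)) r t
      have Q := ((A.const_mul (-sin t)).add (B.const_mul (cos t))).fun_pow 2
      refine ((ww_deriv a b r (by linarith [hr.1]) hb).mul ((hasDerivAt_id' r).mul Q)).congr_deriv ?_
      simp only [hF2, hU, hV, hu, hv, pd_symm f hf, Pi.add_apply, Pi.mul_apply]
      push_cast
      ring
    rw [intervalIntegral.integral_eq_sub_of_hasDerivAt hq]
    · simp [ww_a a b ha hb, ww_b a b ha hb]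
    · apply ContinuousOn.intervalIntegrable
      rw [Set.uIcc_of_le hab]
      refine cF2.comp (by fun_prop) (fun r hr => ⟨lt_of_lt_of_le ha hr.1, trivial⟩)
  have : ∫ p in SS a b, (F1 p - F2 p) = (∫ p in SS a b, F1 p) - ∫ p in SS a b, F2 p :=
    integral_sub (int_SS a b ha F1 cF1) (int_SS a b ha F2 cF2)
  rw [n2, sub_zero] at this
  rw [← this] at n1
  refine n1.trans_eq ?_
  congr 1
  funext p
  simp only [hF1, hF2]
  ring

theorem algB (h r w w' m1 m2 N : ℝ) (hh : 0 < h) (hr : 0 < r) (h0 : 0 ≤ w) (h1 : w ≤ 1 / r)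
    (h2 : |w'| ≤ 4 / r ^ 2) (hm1 : m1 ^ 2 ≤ N) (hm2 : m2 ^ 2 ≤ N) :
    -(25 / 4 * h ^ 2 / r ^ 3) ≤ w * m1 + w' * r * m2 + r * (N / h ^ 2) := by
  have hN : 0 ≤ N := (sq_nonneg _).trans hm1
  set X := √N with hX
  have hX0 : 0 ≤ X := Real.sqrt_nonneg _
  have hXN : X ^ 2 = N := Real.sq_sqrt hN
  have a1 : |m1| ≤ X := Real.abs_le_sqrt hm1
  have a2 : |m2| ≤ X := Real.abs_le_sqrt hm2
  have b1 : |w * m1| ≤ 1 / r * X := by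
    rw [abs_mul, abs_of_nonneg h0]; gcongr
  have b2 : |w' * r * m2| ≤ 4 / r ^ 2 * r * X := by
    rw [abs_mul, abs_mul, abs_of_pos hr]; gcongr
  have b3 : 4 / r ^ 2 * r * X = 4 * (1 / r * X) := by field_simp
  have b4 : r * (X / h - 5 / 2 * h / r ^ 2) ^ 2 =
      r * (X ^ 2 / h ^ 2) + 25 / 4 * h ^ 2 / r ^ 3 - 5 * (1 / r * X) := by
    field_simp; ring
  have b5 : 0 ≤ r * (X / h - 5 / 2 * h / r ^ 2) ^ 2 := by positivity
  have := neg_abs_le (w * m1)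
  have := neg_abs_le (w' * r * m2)
  rw [← hXN]
  linarith

theorem gDelta_PP (Δ : ℝ) (p : ℝ × ℝ) (hp : 0 < p.1) :
    gDelta Δ (PP p) = !![1 - Δ ^ 2 * sin p.2 ^ 2, Δ ^ 2 * sin p.2 * cos p.2;
      Δ ^ 2 * sin p.2 * cos p.2, 1 - Δ ^ 2 * cos p.2 ^ 2] := by
  have hn := PP_norm p hp.le
  ext i j
  unfold gDelta
  rw [hn]
  fin_cases i <;> fin_cases j <;> simp [perpVec, PP] <;> field_simp

theorem rot_sq (c s m00 m01 m10 m11 : ℝ) (h : s ^ 2 + c ^ 2 = 1) :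
    (c ^ 2 * m00 + c * s * (m01 + m10) + s ^ 2 * m11) ^ 2 ≤ m00 ^ 2 + m01 ^ 2 + (m10 ^ 2 + m11 ^ 2) := by
  have e1 : (c * m00 + s * m01) ^ 2 ≤ m00 ^ 2 + m01 ^ 2 := by
    have : m00 ^ 2 + m01 ^ 2 - (c * m00 + s * m01) ^ 2 = (s * m00 - c * m01) ^ 2 := by
      linear_combination (-(m00^2 + m01^2)) * h
    nlinarith [sq_nonneg (s * m00 - c * m01)]
  have e2 : (c * m10 + s * m11) ^ 2 ≤ m10 ^ 2 + m11 ^ 2 := by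
    have : m10 ^ 2 + m11 ^ 2 - (c * m10 + s * m11) ^ 2 = (s * m10 - c * m11) ^ 2 := by
      linear_combination (-(m10^2 + m11^2)) * h
    nlinarith [sq_nonneg (s * m10 - c * m11)]
  set A := c * m00 + s * m01
  set B := c * m10 + s * m11
  have e3 : c ^ 2 * m00 + c * s * (m01 + m10) + s ^ 2 * m11 = c * A + s * B := by
    simp only [A, B]; ring
  rw [e3]
  have : A ^ 2 + B ^ 2 - (c * A + s * B) ^ 2 = (s * A - c * B) ^ 2 := by
    linear_combination (-(A^2 + B^2)) * h
  nlinarith [sq_nonneg (s * A - c * B)]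

theorem hess_bd (c s r w A B C D : ℝ) (h : s ^ 2 + c ^ 2 = 1) (hr : 0 < r) (h1 : w ≤ 1 / r) :
    w * ((r * (-s * A + c * C)) ^ 2 + (r * (-s * B + c * D)) ^ 2) ≤
      r * (A ^ 2 + B ^ 2 + (C ^ 2 + D ^ 2)) := by
  have e1 : (-s * A + c * C) ^ 2 ≤ A ^ 2 + C ^ 2 := by
    have : A ^ 2 + C ^ 2 - (-s * A + c * C) ^ 2 = (c * A + s * C) ^ 2 := by
      linear_combination (-(A^2 + C^2)) * h
    nlinarith [sq_nonneg (c * A + s * C)]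
  have e2 : (-s * B + c * D) ^ 2 ≤ B ^ 2 + D ^ 2 := by
    have : B ^ 2 + D ^ 2 - (-s * B + c * D) ^ 2 = (c * B + s * D) ^ 2 := by
      linear_combination (-(B^2 + D^2)) * h
    nlinarith [sq_nonneg (c * B + s * D)]
  calc _ ≤ 1 / r * ((r * (-s * A + c * C)) ^ 2 + (r * (-s * B + c * D)) ^ 2) := by gcongr
    _ = r * ((-s * A + c * C) ^ 2 + (-s * B + c * D) ^ 2) := by field_simp
    _ ≤ r * ((A ^ 2 + C ^ 2) + (B ^ 2 + D ^ 2)) := by gcongr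
    _ = _ := by ring

/-- The integrand of claimA. -/
def KK (f : E2 → ℝ) (a b : ℝ) (p : ℝ × ℝ) : ℝ :=
      (ww a b p.1 * ((p.1 * (-sin p.2 * pd 0 (pd 0 f) (PP p) + cos p.2 * pd 1 (pd 0 f) (PP p))) ^ 2
        + (p.1 * (-sin p.2 * pd 0 (pd 1 f) (PP p) + cos p.2 * pd 1 (pd 1 f) (PP p))) ^ 2)
      - ww a b p.1 * (cos p.2 * pd 0 f (PP p) + sin p.2 * pd 1 f (PP p)) ^ 2
      - ww' a b p.1 * p.1 * (-sin p.2 * pd 0 f (PP p) + cos p.2 * pd 1 f (PP p)) ^ 2)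

/-- The explicit part. -/
def EE (Δ a b r : ℝ) : ℝ :=
  ww a b r + (1 - Δ ^ 2) * (r * ww' a b r) - 25 / 4 * a ^ 2 / r ^ 3

theorem claimB (Δ h R : ℝ) (y : E2 → E3) (p : ℝ × ℝ) (hh : 0 < h) (h1 : h ≤ p.1) (h2 : p.1 ≤ R) :
    (∑ i : Fin 3, KK (fun z => y z i) h R p) + EE Δ h R p.1 ≤
      p.1 * (frob2 (gmet y (PP p) - gDelta Δ (PP p)) / h ^ 2 + hessNormSq y (PP p)) := by
  have hr : 0 < p.1 := by linarith
  have hcs := Real.sin_sq_add_cos_sq p.2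
  have hw0 := ww_nonneg h R p.1 hh h1 h2
  have hw1 := ww_le h R p.1 hh h1 h2
  have hw2 := ww'_abs h R p.1 hh h1 h2
  rw [gDelta_PP Δ p hr]
  have hH : ∀ f : E2 → ℝ, frob2 (hess f (PP p)) = (pd 0 (pd 0 f) (PP p)) ^ 2 + (pd 0 (pd 1 f) (PP p)) ^ 2
      + ((pd 1 (pd 0 f) (PP p)) ^ 2 + (pd 1 (pd 1 f) (PP p)) ^ 2) := by
    intro f; simp [frob2, hess, Fin.sum_univ_two]
  have hB := fun i : Fin 3 => hess_bd (cos p.2) (sin p.2) p.1 (ww h R p.1)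
    (pd 0 (pd 0 fun z => y z i) (PP p)) (pd 0 (pd 1 fun z => y z i) (PP p))
    (pd 1 (pd 0 fun z => y z i) (PP p)) (pd 1 (pd 1 fun z => y z i) (PP p)) hcs hr hw1
  set M := gmet y (PP p) - !![1 - Δ ^ 2 * sin p.2 ^ 2, Δ ^ 2 * sin p.2 * cos p.2;
      Δ ^ 2 * sin p.2 * cos p.2, 1 - Δ ^ 2 * cos p.2 ^ 2] with hM
  have hfM : frob2 M = M 0 0 ^ 2 + M 0 1 ^ 2 + (M 1 0 ^ 2 + M 1 1 ^ 2) := by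
    simp [frob2, Fin.sum_univ_two]
  have r1 := rot_sq (cos p.2) (sin p.2) (M 0 0) (M 0 1) (M 1 0) (M 1 1) hcs
  have r2 := rot_sq (-sin p.2) (cos p.2) (M 0 0) (M 0 1) (M 1 0) (M 1 1) (by linarith)
  rw [← hfM] at r1 r2
  have key := algB h p.1 _ _ _ _ _ hh hr hw0 hw1 hw2 r1 r2
  set d : Fin 3 → Fin 2 → ℝ := fun i j => pd j (fun z => y z i) (PP p) with hd
  have g00 : M 0 0 = d 0 0 ^ 2 + d 1 0 ^ 2 + d 2 0 ^ 2 - (1 - Δ ^ 2 * sin p.2 ^ 2) := by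
    simp [hM, gmet, Dmat, Matrix.mul_apply, Fin.sum_univ_three, hd]; ring
  have g01 : M 0 1 = d 0 0 * d 0 1 + d 1 0 * d 1 1 + d 2 0 * d 2 1 - Δ ^ 2 * sin p.2 * cos p.2 := by
    simp [hM, gmet, Dmat, Matrix.mul_apply, Fin.sum_univ_three, hd]
  have g10 : M 1 0 = d 0 0 * d 0 1 + d 1 0 * d 1 1 + d 2 0 * d 2 1 - Δ ^ 2 * sin p.2 * cos p.2 := by
    simp [hM, gmet, Dmat, Matrix.mul_apply, Fin.sum_univ_three, hd]; ring
  have g11 : M 1 1 = d 0 1 ^ 2 + d 1 1 ^ 2 + d 2 1 ^ 2 - (1 - Δ ^ 2 * cos p.2 ^ 2) := by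
    simp [hM, gmet, Dmat, Matrix.mul_apply, Fin.sum_univ_three, hd]; ring
  have k1 : cos p.2 ^ 2 * M 0 0 + cos p.2 * sin p.2 * (M 0 1 + M 1 0) + sin p.2 ^ 2 * M 1 1 =
      (∑ i, (cos p.2 * d i 0 + sin p.2 * d i 1) ^ 2) - 1 := by
    rw [g00, g01, g10, g11, Fin.sum_univ_three]
    linear_combination (-1) * hcs
  have k2 : (-sin p.2) ^ 2 * M 0 0 + (-sin p.2) * cos p.2 * (M 0 1 + M 1 0) + cos p.2 ^ 2 * M 1 1 =
      (∑ i, (-sin p.2 * d i 0 + cos p.2 * d i 1) ^ 2) - (1 - Δ ^ 2) := by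
    rw [g00, g01, g10, g11, Fin.sum_univ_three]
    linear_combination (-1 + Δ ^ 2 * (sin p.2 ^ 2 + cos p.2 ^ 2 + 1)) * hcs
  rw [k1, k2] at key
  simp only [hessNormSq, hH, KK, EE, Fin.sum_univ_three] at *
  have := hB 0
  have := hB 1
  have := hB 2
  linarith

theorem claimC (Δ h R : ℝ) (hh : 0 < h) (hR : h < R) :
    2 * π * (Δ ^ 2 * (Real.log (R / h) - 2) - 25 / 8) ≤ ∫ p in SS h R, EE Δ h R p.1 := by
  have hR0 : 0 < R := by linarith
  have cE : ContinuousOn (EE Δ h R) (Set.Ioi 0) := by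
    unfold EE
    have c1 := ww_cont h R hR0
    have c2 := ww'_cont h R hR0
    have c3 : ContinuousOn (fun r : ℝ => 25 / 4 * h ^ 2 / r ^ 3) (Set.Ioi 0) := by
      intro r hr
      have hr : r ≠ 0 := ne_of_gt hr
      apply ContinuousAt.continuousWithinAt
      fun_prop (disch := positivity)
    fun_prop
  have hi := int_SS h R hh (fun p => EE Δ h R p.1)
    (cE.comp continuous_fst.continuousOn (fun p hp => hp.1))
  unfold SS at hi ⊢
  rw [Measure.volume_eq_prod] at hi ⊢
  rw [setIntegral_prod _ hi]
  have hc : ∀ c : ℝ, ∫ _t in Set.Ioo (-π) π, c = (2 * π) * c := by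
    intro c
    rw [setIntegral_const, measureReal_def, Real.volume_Ioo, ENNReal.toReal_ofReal (by linarith [Real.pi_pos])]
    rw [smul_eq_mul]; ring
  simp only [hc]
  rw [integral_const_mul]
  gcongr
  rw [integral_Ico_eq_integral_Ioc, ← intervalIntegral.integral_of_le hR.le]
  set W : ℝ → ℝ := fun r => (1 + h / R) * Real.log r + h * r⁻¹ - r / R with hW
  have hd : ∀ r ∈ Set.uIcc h R, HasDerivAt (fun r => W r + (1 - Δ ^ 2) * (r * ww h R r - W r)
      + 25 / 8 * h ^ 2 * (r ^ 2)⁻¹) (EE Δ h R r) r := by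
    intro r hr
    rw [Set.uIcc_of_le hR.le] at hr
    have hr0 : 0 < r := by linarith [hr.1]
    have hWd : HasDerivAt W (ww h R r) r := by
      refine ((((Real.hasDerivAt_log hr0.ne').const_mul (1 + h / R)).add
        ((hasDerivAt_inv hr0.ne').const_mul h)).sub ((hasDerivAt_id' r).div_const R)).congr_deriv ?_
      unfold ww; field_simp; ring
    have h3 := ((hasDerivAt_id' r).fun_pow 2).fun_inv (by positivity)
    refine ((hWd.add ((((hasDerivAt_id' r).mul (ww_deriv h R r hr0 hR0)).sub hWd).const_mul
      (1 - Δ ^ 2))).add (h3.const_mul (25 / 8 * h ^ 2))).congr_deriv ?_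
    unfold EE
    simp only [Nat.cast_ofNat, mul_one]
    field_simp
    ring
  rw [intervalIntegral.integral_eq_sub_of_hasDerivAt hd]
  · simp only [ww_a h R hh hR0, ww_b h R hh hR0, hW]
    rw [Real.log_div hR0.ne' hh.ne']
    have hl : Real.log h ≤ Real.log R := Real.log_le_log hh hR.le
    have hx : 0 < h / R := by positivity
    have e1 : h * R⁻¹ = h / R := by ring
    have e2 : h * h⁻¹ = 1 := by field_simp
    have e3 : R / R = 1 := by field_simp
    have e4 : 25 / 8 * h ^ 2 * (h ^ 2)⁻¹ = 25 / 8 := by field_simp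
    have e5 : 0 < 25 / 8 * h ^ 2 * (R ^ 2)⁻¹ := by positivity
    rw [e1, e2, e3, e4]
    have e6 : 0 ≤ Δ ^ 2 * (h / R * (Real.log R - Real.log h) + 2 * (h / R)) := by
      have : 0 ≤ Real.log R - Real.log h := by linarith
      positivity
    linarith
  · apply ContinuousOn.intervalIntegrable
    rw [Set.uIcc_of_le hR.le]
    exact cE.mono (fun r hr => lt_of_lt_of_le hh hr.1)

theorem KK_cont (f : E2 → ℝ) (hf : ContDiff ℝ 2 f) (a b : ℝ) (hb : 0 < b) :
    ContinuousOn (KK f a b) HP := by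
  have d0 := (pd_contDiff f hf 0)
  have d1 := (pd_contDiff f hf 1)
  have c0 := d0.continuous
  have c1 := d1.continuous
  have c00 := pd_cont _ d0 0
  have c10 := pd_cont _ d0 1
  have c01 := pd_cont _ d1 0
  have c11 := pd_cont _ d1 1
  have hP := PP_cont
  have cw : ContinuousOn (fun p : ℝ × ℝ => ww a b p.1) HP :=
    (ww_cont a b hb).comp continuous_fst.continuousOn (fun p hp => hp.1)
  have cw' : ContinuousOn (fun p : ℝ × ℝ => ww' a b p.1) HP :=
    (ww'_cont a b hb).comp continuous_fst.continuousOn (fun p hp => hp.1)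
  unfold KK
  exact ((cw.mul (Continuous.continuousOn (by fun_prop))).sub
    (cw.mul (Continuous.continuousOn (by fun_prop)))).sub
    ((cw'.mul (Continuous.continuousOn (by fun_prop))).mul (Continuous.continuousOn (by fun_prop)))

theorem EE_cont (Δ h R : ℝ) (hR0 : 0 < R) :
    ContinuousOn (fun p : ℝ × ℝ => EE Δ h R p.1) HP := by
  have cE : ContinuousOn (EE Δ h R) (Set.Ioi 0) := by
    unfold EE
    have c1 := ww_cont h R hR0
    have c2 := ww'_cont h R hR0
    have c3 : ContinuousOn (fun r : ℝ => 25 / 4 * h ^ 2 / r ^ 3) (Set.Ioi 0) := by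
      intro r hr
      have hr : r ≠ 0 := ne_of_gt hr
      apply ContinuousAt.continuousWithinAt
      fun_prop (disch := positivity)
    fun_prop
  exact cE.comp continuous_fst.continuousOn (fun p hp => hp.1)

theorem comp_contDiff (y : E2 → E3) (hy : ContDiff ℝ 2 y) (i : Fin 3) :
    ContDiff ℝ 2 (fun z => y z i) := by
  exact (contDiff_euclidean.1 hy) i

theorem hess_cont (y : E2 → E3) (hy : ContDiff ℝ 2 y) : Continuous (hessNormSq y) := by
  have : ∀ i : Fin 3, ∀ j k : Fin 2, Continuous (pd j (pd k fun z => y z i)) := fun i j k =>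
    pd_cont _ (pd_contDiff _ (comp_contDiff y hy i) k) j
  unfold hessNormSq frob2 hess
  simp only [Matrix.of_apply]
  fun_prop

theorem gmet_cont (y : E2 → E3) (hy : ContDiff ℝ 2 y) (j k : Fin 2) :
    Continuous (fun x => gmet y x j k) := by
  have : ∀ i : Fin 3, ∀ k : Fin 2, Continuous (pd k fun z => y z i) := fun i k =>
    (pd_contDiff _ (comp_contDiff y hy i) k).continuous
  unfold gmet Dmat
  simp only [Matrix.mul_apply, Matrix.transpose_apply, Matrix.of_apply]
  fun_prop

theorem gDelta_meas (Δ : ℝ) (j k : Fin 2) : Measurable (fun x => gDelta Δ x j k) := by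
  have hp : ∀ i : Fin 2, Measurable (fun x => perpVec x i) := by
    intro i
    apply Continuous.measurable
    fin_cases i <;> simp [perpVec] <;> fun_prop
  unfold gDelta
  simp only [Matrix.sub_apply, Matrix.of_apply]
  have := hp j
  have := hp k
  fun_prop

theorem gDelta_bd (Δ : ℝ) (j k : Fin 2) (x : E2) : |gDelta Δ x j k| ≤ 1 + Δ ^ 2 := by
  have hp : ∀ i : Fin 2, |perpVec x i| ≤ ‖x‖ := by
    intro i
    fin_cases i
    · simpa [perpVec] using PiLp.norm_apply_le x 1
    · simpa [perpVec] using PiLp.norm_apply_le x 0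
  unfold gDelta
  simp only [Matrix.sub_apply, Matrix.of_apply]
  refine (abs_sub _ _).trans (add_le_add ?_ ?_)
  · rw [Matrix.one_apply]; split_ifs <;> simp
  · rw [abs_mul, abs_mul, abs_of_nonneg (show 0 ≤ Δ ^ 2 / ‖x‖ ^ 2 by positivity)]
    by_cases hx : ‖x‖ = 0
    · rw [hx]; simp; positivity
    · calc _ ≤ Δ ^ 2 / ‖x‖ ^ 2 * ‖x‖ * ‖x‖ := by
            have := hp j
            have := hp k
            gcongr
        _ = Δ ^ 2 := by field_simp

theorem frob_int (Δ : ℝ) (y : E2 → E3) (hy : ContDiff ℝ 2 y) :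
    IntegrableOn (fun x => frob2 (gmet y x - gDelta Δ x)) (ball (0 : E2) 1) := by
  unfold frob2
  simp only [Matrix.sub_apply]
  refine integrable_finsetSum _ fun j _ => integrable_finsetSum _ fun k _ => ?_
  obtain ⟨C, hC⟩ := (isCompact_closedBall (0 : E2) 1).exists_bound_of_continuousOn
    (gmet_cont y hy j k).continuousOn
  refine Measure.integrableOn_of_bounded (M := (C + (1 + Δ ^ 2)) ^ 2) measure_ball_lt_top.ne ?_ ?_
  · exact (((gmet_cont y hy j k).measurable.sub (gDelta_meas Δ j k)).pow_const 2).aestronglyMeasurable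
  · refine ae_restrict_of_forall_mem measurableSet_ball fun x hx => ?_
    rw [Real.norm_eq_abs, abs_pow]
    gcongr
    refine (abs_sub _ _).trans (add_le_add ?_ (gDelta_bd Δ j k x))
    exact hC x (ball_subset_closedBall hx)

theorem frob_cont (Δ : ℝ) (y : E2 → E3) (hy : ContDiff ℝ 2 y) :
    ContinuousOn (fun p => frob2 (gmet y (PP p) - gDelta Δ (PP p))) HP := by
  have hg := gmet_cont y hy
  have hP := PP_cont
  have : ContinuousOn (fun p : ℝ × ℝ => frob2 (gmet y (PP p) -
      !![1 - Δ ^ 2 * sin p.2 ^ 2, Δ ^ 2 * sin p.2 * cos p.2;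
      Δ ^ 2 * sin p.2 * cos p.2, 1 - Δ ^ 2 * cos p.2 ^ 2])) HP := by
    apply Continuous.continuousOn
    have hg' : ∀ j k, Continuous fun p => gmet y (PP p) j k := fun j k => (hg j k).comp hP
    simp [frob2, Fin.sum_univ_two]
    fun_prop
  refine this.congr fun p hp => ?_
  simp only [gDelta_PP Δ p hp.1]

theorem lower (Δ h R : ℝ) (hh : 0 < h) (hR : h < R) (y : E2 → E3) (hy : ContDiff ℝ 2 y) :
    2 * π * (Δ ^ 2 * (Real.log (R / h) - 2) - 25 / 8) ≤
      ∫ x in ball (0 : E2) R \ ball 0 h,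
        (frob2 (gmet y x - gDelta Δ x) / h ^ 2 + hessNormSq y x) := by
  have hR0 : 0 < R := by linarith
  rw [polar_int _ h R hh]
  change _ ≤ ∫ p in SS h R, _
  have hK : ∀ i : Fin 3, IntegrableOn (KK (fun z => y z i) h R) (SS h R) := fun i =>
    int_SS h R hh _ (KK_cont _ (comp_contDiff y hy i) h R hR0)
  have hKs : IntegrableOn (fun p => ∑ i : Fin 3, KK (fun z => y z i) h R p) (SS h R) :=
    integrable_finsetSum _ fun i _ => hK i
  have hE := int_SS h R hh _ (EE_cont Δ h R hR0)
  have hG : IntegrableOn (fun p : ℝ × ℝ => p.1 * (frob2 (gmet y (PP p) - gDelta Δ (PP p)) / h ^ 2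
      + hessNormSq y (PP p))) (SS h R) := by
    apply int_SS h R hh
    exact continuous_fst.continuousOn.mul (((frob_cont Δ y hy).div_const _).add
      ((hess_cont y hy).comp PP_cont).continuousOn)
  have mono := setIntegral_mono_on (hKs.add hE) hG (SS_meas h R)
    (fun p hp => claimB Δ h R y p hh hp.1.1 hp.1.2.le)
  refine le_trans ?_ mono
  have : ∫ p in SS h R, ((fun p => ∑ i : Fin 3, KK (fun z => y z i) h R p) + fun p : ℝ × ℝ => EE Δ h R p.1) p
      = (∑ i : Fin 3, ∫ p in SS h R, KK (fun z => y z i) h R p) + ∫ p in SS h R, EE Δ h R p.1 := by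
    rw [integral_add' hKs hE, integral_finsetSum _ (fun i _ => hK i)]
  rw [this]
  have h1 : 0 ≤ ∑ i : Fin 3, ∫ p in SS h R, KK (fun z => y z i) h R p :=
    Finset.sum_nonneg fun i _ => claimA _ (comp_contDiff y hy i) h R hh hR.le
  have := claimC Δ h R hh hR
  linarith

/-- bending-energy bound on annuli for almost-minimizers. -/
theorem stmt_2 (Δ : ℝ) (hΔ0 : 0 < Δ) (hΔ1 : Δ < 1) (C₂ : ℝ) (hC₂ : 0 < C₂) :
    ∃ C₃ > (0 : ℝ), ∃ h₀ ∈ Set.Ioo (0 : ℝ) 1, ∀ h ∈ Set.Ioo (0 : ℝ) h₀,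
      ∀ y : E2 → E3, ContDiff ℝ 2 y →
        energy h Δ y ≤ 2 * π * Δ ^ 2 * h ^ 2 * (Real.log (1 / h) + C₂) →
        ∀ R ∈ Set.Ioo (2 * h) 1,
          ∫ x in ball (0 : E2) 1 \ ball 0 R, hessNormSq y x ≤
            2 * π * Δ ^ 2 * Real.log (1 / R) + C₃ := by
  refine ⟨2 * π * Δ ^ 2 * C₂ + 2 * π * (2 * Δ ^ 2 + 25 / 8), by positivity, 1 / 2,
    ⟨by norm_num, by norm_num⟩, ?_⟩
  rintro h ⟨hh, hh1⟩ y hy hE R ⟨hR2, hR1⟩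
  have hR : h < R := by linarith
  have hR0 : 0 < R := by linarith
  have low := lower Δ h R hh hR y hy
  have hFi := frob_int Δ y hy
  have hHi : IntegrableOn (hessNormSq y) (ball (0 : E2) 1) :=
    ((hess_cont y hy).continuousOn.integrableOn_compact (isCompact_closedBall (0 : E2) 1)).mono_set
      ball_subset_closedBall
  set G : E2 → ℝ := fun x => frob2 (gmet y x - gDelta Δ x) + h ^ 2 * hessNormSq y x with hG
  have hGi : IntegrableOn G (ball (0 : E2) 1) := hFi.add (hHi.const_mul _)
  have hfn : ∀ x, 0 ≤ frob2 (gmet y x - gDelta Δ x) := fun x =>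
    Finset.sum_nonneg fun i _ => Finset.sum_nonneg fun j _ => sq_nonneg _
  have hHn : ∀ x, 0 ≤ hessNormSq y x := fun x =>
    Finset.sum_nonneg fun i _ => Finset.sum_nonneg fun j _ => Finset.sum_nonneg fun k _ => sq_nonneg _
  have hGn : ∀ x, 0 ≤ G x := fun x => add_nonneg (hfn x) (mul_nonneg (sq_nonneg _) (hHn x))
  set A1 := ball (0 : E2) R \ ball 0 h with hA1
  set A2 := ball (0 : E2) 1 \ ball 0 R with hA2
  have m1 : MeasurableSet A1 := measurableSet_ball.diff measurableSet_ball
  have m2 : MeasurableSet A2 := measurableSet_ball.diff measurableSet_ball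
  have s1 : A1 ⊆ ball (0 : E2) 1 := fun x hx => ball_subset_ball hR1.le hx.1
  have s2 : A2 ⊆ ball (0 : E2) 1 := fun x hx => hx.1
  have hdis : Disjoint A1 A2 := Set.disjoint_left.2 fun x hx hx' => hx'.2 hx.1
  have e1 : (∫ x in A1, G x) + ∫ x in A2, G x ≤ energy h Δ y := by
    rw [← setIntegral_union hdis m2 (hGi.mono_set s1) (hGi.mono_set s2)]
    exact setIntegral_mono_set hGi (Eventually.of_forall hGn)
      (Set.union_subset s1 s2).eventuallyLE
  have e2 : h ^ 2 * ∫ x in A2, hessNormSq y x ≤ ∫ x in A2, G x := by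
    rw [← integral_const_mul]
    refine setIntegral_mono_on ((hHi.mono_set s2).const_mul _) (hGi.mono_set s2) m2 fun x _ => ?_
    have := hfn x
    simp only [hG]; linarith
  have e3 : ∫ x in A1, G x = h ^ 2 * ∫ x in A1, (frob2 (gmet y x - gDelta Δ x) / h ^ 2 + hessNormSq y x) := by
    rw [← integral_const_mul]
    congr 1
    funext x
    simp only [hG]; field_simp
  rw [e3] at e1
  have hh2 : 0 < h ^ 2 := by positivity
  have e4 : h ^ 2 * (2 * π * (Δ ^ 2 * (Real.log (R / h) - 2) - 25 / 8) + ∫ x in A2, hessNormSq y x) ≤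
      h ^ 2 * (2 * π * Δ ^ 2 * (Real.log (1 / h) + C₂)) := by
    have := mul_le_mul_of_nonneg_left low hh2.le
    linarith
  have e5 := le_of_mul_le_mul_left e4 hh2
  rw [Real.log_div hR0.ne' hh.ne', one_div, Real.log_inv] at e5
  rw [one_div, Real.log_inv]
  linarith
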